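/- arXiv:2307.05540 — 2 statements merged into one kernel-verified Lean document; each statement's English description precedes it below -/
import Mathlib

section
/- Let B be a finitely generated skew brace such that B/Soc(B) is finite and the group (B,∘) is virtually abelian. Then B contains an ideal I such that: (1) I is a finitely generated trivial brace; (2) I is contained in Soc(B); (3) B/I is finite; (4) every element x of I has only finitely many conjugates in B, where a conjugate of x is any element of the form g∗x, x∗g, g∘x∘g^{-1}, or g+x−g with g ∈ B. In particular, the groups (B,+) and (B,∘) are finitely presented. -/
universe u v

/-- A skew (left) brace: two group structures `(B,+)` and `(B,∘)` on the same set,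
sharing the same identity element `zero` (recall that in any skew brace `0 = 1`),
satisfying the skew left distributive law `a ∘ (b + c) = a ∘ b - a + a ∘ c`. -/
structure SkewBrace (B : Type u) where
  add : B → B → B
  zero : B
  neg : B → B
  mul : B → B → B
  inv : B → B
  add_assoc : ∀ a b c, add (add a b) c = add a (add b c)
  zero_add : ∀ a, add zero a = a
  add_zero : ∀ a, add a zero = a
  neg_add : ∀ a, add (neg a) a = zero
  add_neg : ∀ a, add a (neg a) = zero
  mul_assoc : ∀ a b c, mul (mul a b) c = mul a (mul b c)
  zero_mul : ∀ a, mul zero a = a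
  mul_zero : ∀ a, mul a zero = a
  inv_mul : ∀ a, mul (inv a) a = zero
  mul_inv : ∀ a, mul a (inv a) = zero
  compat : ∀ a b c, mul a (add b c) = add (add (mul a b) (neg a)) (mul a c)

namespace SkewBrace

variable {B C Q : Type u}

/-- `λ_a (b) = -a + a ∘ b`. -/
def lam (S : SkewBrace B) (a b : B) : B := S.add (S.neg a) (S.mul a b)

/-- `a ∗ b = λ_a(b) - b = -a + a ∘ b - b`. -/
def star (S : SkewBrace B) (a b : B) : B := S.add (S.lam a b) (S.neg b)

/-- A sub-skew brace: a subset containing the identity and closed under both group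
operations and both inverses. -/
def IsSub (S : SkewBrace B) (T : Set B) : Prop :=
  S.zero ∈ T ∧ (∀ a ∈ T, ∀ b ∈ T, S.add a b ∈ T) ∧ (∀ a ∈ T, S.neg a ∈ T) ∧
    (∀ a ∈ T, ∀ b ∈ T, S.mul a b ∈ T) ∧ (∀ a ∈ T, S.inv a ∈ T)

/-- The sub-skew brace generated by a subset. -/
def subGen (S : SkewBrace B) (X : Set B) : Set B := ⋂₀ {T | S.IsSub T ∧ X ⊆ T}

/-- A skew brace is finitely generated if a finite subset generates it. -/
def FinitelyGenerated (S : SkewBrace B) : Prop := ∃ T : Finset B, S.subGen ↑T = Set.univ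

/-- A subgroup of the additive group `(B,+)`. -/
def IsAddSubgroup (S : SkewBrace B) (T : Set B) : Prop :=
  S.zero ∈ T ∧ (∀ a ∈ T, ∀ b ∈ T, S.add a b ∈ T) ∧ ∀ a ∈ T, S.neg a ∈ T

/-- A subgroup of the multiplicative group `(B,∘)`. -/
def IsMulSubgroup (S : SkewBrace B) (T : Set B) : Prop :=
  S.zero ∈ T ∧ (∀ a ∈ T, ∀ b ∈ T, S.mul a b ∈ T) ∧ ∀ a ∈ T, S.inv a ∈ T

/-- The additive subgroup generated by a subset. -/
def addClosure (S : SkewBrace B) (X : Set B) : Set B := ⋂₀ {T | S.IsAddSubgroup T ∧ X ⊆ T}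

/-- The multiplicative subgroup generated by a subset. -/
def mulClosure (S : SkewBrace B) (X : Set B) : Set B := ⋂₀ {T | S.IsMulSubgroup T ∧ X ⊆ T}

/-- The group `(B,+)` is finitely generated. -/
def AddFG (S : SkewBrace B) : Prop := ∃ T : Finset B, S.addClosure ↑T = Set.univ

/-- The group `(B,∘)` is finitely generated. -/
def MulFG (S : SkewBrace B) : Prop := ∃ T : Finset B, S.mulClosure ↑T = Set.univ

/-- An ideal of a skew brace: a subgroup of `(B,+)`, normal in `(B,+)` and in `(B,∘)`,
invariant under all the maps `λ_b`. -/
def IsIdeal (S : SkewBrace B) (I : Set B) : Prop :=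
  S.IsAddSubgroup I ∧ (∀ b : B, ∀ a ∈ I, S.add (S.add b a) (S.neg b) ∈ I) ∧
    (∀ b : B, ∀ a ∈ I, S.mul (S.mul b a) (S.inv b) ∈ I) ∧
    ∀ b : B, ∀ a ∈ I, S.lam b a ∈ I

/-- The ideal generated by a subset (the smallest ideal containing it). -/
def idealGen (S : SkewBrace B) (X : Set B) : Set B := ⋂₀ {I | S.IsIdeal I ∧ X ⊆ I}

/-- A homomorphism of skew braces. -/
def IsHom (S : SkewBrace B) (T : SkewBrace C) (f : B → C) : Prop :=
  (∀ a b, f (S.add a b) = T.add (f a) (f b)) ∧ ∀ a b, f (S.mul a b) = T.mul (f a) (f b)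

/-- `SF` together with `ι : X → F` is the free skew brace on `X`: every map from `X`
to a skew brace extends uniquely to a homomorphism. -/
def IsFreeOn {F : Type u} {X : Type v} (SF : SkewBrace F) (ι : X → F) : Prop :=
  ∀ (C : Type u) (SC : SkewBrace C) (f : X → C),
    ∃! g : F → C, IsHom SF SC g ∧ ∀ x, g (ι x) = f x

/-- A skew brace is finitely presented if it is the image of a free skew brace on a
finite set under a homomorphism whose kernel is generated, as an ideal, by finitely
many elements. -/
def FinitelyPresented (S : SkewBrace B) : Prop :=
  ∃ (F : Type u) (SF : SkewBrace F) (m : ℕ) (ι : Fin m → F) (θ : F → B),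
    IsFreeOn SF ι ∧ IsHom SF S θ ∧ Function.Surjective θ ∧
      ∃ R : Finset F, {x | θ x = S.zero} = SF.idealGen ↑R

/-- `π : B → Q` realizes `Q` as the quotient skew brace `B/I`. -/
def IsQuotientBy (S : SkewBrace B) (I : Set B) (SQ : SkewBrace Q) (π : B → Q) : Prop :=
  IsHom S SQ π ∧ Function.Surjective π ∧ {x | π x = SQ.zero} = I

/-- The group `(B,+)` is finitely presented (as an abstract group). -/
def AddFP (S : SkewBrace B) : Prop :=
  ∃ (m : ℕ) (f : FreeGroup (Fin m) → B),
    (∀ x y, f (x * y) = S.add (f x) (f y)) ∧ Function.Surjective f ∧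
      ∃ R : Finset (FreeGroup (Fin m)),
        {x | f x = S.zero} = ↑(Subgroup.normalClosure (R : Set (FreeGroup (Fin m))))

/-- The group `(B,∘)` is finitely presented (as an abstract group). -/
def MulFP (S : SkewBrace B) : Prop :=
  ∃ (m : ℕ) (f : FreeGroup (Fin m) → B),
    (∀ x y, f (x * y) = S.mul (f x) (f y)) ∧ Function.Surjective f ∧
      ∃ R : Finset (FreeGroup (Fin m)),
        {x | f x = S.zero} = ↑(Subgroup.normalClosure (R : Set (FreeGroup (Fin m))))

/-- The ascending chain condition on sub-skew braces. -/
def SubACC (S : SkewBrace B) : Prop :=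
  ∀ f : ℕ → Set B, Monotone f → (∀ n, S.IsSub (f n)) → ∃ n, ∀ m, n ≤ m → f m = f n

/-- The ascending chain condition on subgroups of `(B,+)`. -/
def AddACC (S : SkewBrace B) : Prop :=
  ∀ f : ℕ → Set B, Monotone f → (∀ n, S.IsAddSubgroup (f n)) → ∃ n, ∀ m, n ≤ m → f m = f n

/-- The socle `Soc(B) = Ker(λ) ∩ Z(B,+)`. -/
def soc (S : SkewBrace B) : Set B :=
  {x | (∀ b, S.lam x b = b) ∧ ∀ b, S.add x b = S.add b x}

/-- The centre of the additive group `(B,+)`. -/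
def addCenter (S : SkewBrace B) : Set B := {x | ∀ b, S.add x b = S.add b x}

/-- The preimage in `B` of `Ann(B/I)` (for `I` an ideal): the set of `x` such that,
modulo `I`, `λ_x = id`, `x` is central in `(B,+)` and `x` is central in `(B,∘)`. -/
def annStep (S : SkewBrace B) (I : Set B) : Set B :=
  {x | (∀ b, S.add (S.lam x b) (S.neg b) ∈ I) ∧
       (∀ b, S.add (S.add x b) (S.neg (S.add b x)) ∈ I) ∧
       ∀ b, S.mul (S.mul x b) (S.inv (S.mul b x)) ∈ I}

/-- The preimage in `B` of `Soc(B/I)` (for `I` an ideal). -/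
def socStep (S : SkewBrace B) (I : Set B) : Set B :=
  {x | (∀ b, S.add (S.lam x b) (S.neg b) ∈ I) ∧
       ∀ b, S.add (S.add x b) (S.neg (S.add b x)) ∈ I}

/-- The upper annihilator series `Ann_α(B)`, defined by transfinite recursion. -/
noncomputable def annSeries (S : SkewBrace B) (o : Ordinal.{v}) : Set B :=
  Ordinal.limitRecOn o {S.zero} (fun _ ih => S.annStep ih)
    fun _o _ ih => ⋃ β, ⋃ h : β < _o, ih β h

/-- The upper socle series `Soc_α(B)`, defined by transfinite recursion. -/
noncomputable def socSeries (S : SkewBrace B) (o : Ordinal.{v}) : Set B :=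
  Ordinal.limitRecOn o {S.zero} (fun _ ih => S.socStep ih)
    fun _o _ ih => ⋃ β, ⋃ h : β < _o, ih β h

/-- The solution of the YBE associated with a skew brace:
`r_B(a,b) = (λ_a(b), λ_a(b)⁻¹ ∘ a ∘ b)`. -/
def braceR (S : SkewBrace B) : B × B → B × B :=
  fun p => (S.lam p.1 p.2, S.mul (S.inv (S.lam p.1 p.2)) (S.mul p.1 p.2))

end SkewBrace

/-- The set-theoretic Yang–Baxter (braid) equation
`(r × id)(id × r)(r × id) = (id × r)(r × id)(id × r)`. -/
def ybe {X : Type u} (r : X × X → X × X) : Prop :=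
  let r₁ : X × X × X → X × X × X := fun p =>
    ((r (p.1, p.2.1)).1, (r (p.1, p.2.1)).2, p.2.2)
  let r₂ : X × X × X → X × X × X := fun p => (p.1, r p.2)
  r₁ ∘ r₂ ∘ r₁ = r₂ ∘ r₁ ∘ r₂

/-- A non-degenerate set-theoretic solution: `r` is bijective, satisfies the YBE, and
writing `r (x,y) = (σ_x y, τ_y x)`, all maps `σ_x` and `τ_y` are bijective. -/
def IsNonDegenerateSolution {X : Type u} (r : X × X → X × X) : Prop :=
  Function.Bijective r ∧ ybe r ∧
    (∀ x, Function.Bijective fun y => (r (x, y)).1) ∧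
    ∀ y, Function.Bijective fun x => (r (x, y)).2

/-- `S` (with the distinguished map `ι : X → B`) is the structure skew brace of the
solution `(X,r)`: the multiplicative group of `S` is the structure group
`G(X,r) = ⟨X | x y = σ_x(y) τ_y(x)⟩` (expressed by the relations holding together
with the universal property of the presentation) and `r_S ∘ (ι × ι) = (ι × ι) ∘ r`. -/
def IsStructureSkewBrace {X B : Type u} (r : X × X → X × X)
    (S : SkewBrace B) (ι : X → B) : Prop :=
  (∀ x y, S.mul (ι x) (ι y) = S.mul (ι (r (x, y)).1) (ι (r (x, y)).2)) ∧
  (∀ (H : Type u) [Group H] (f : X → H),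
      (∀ x y, f x * f y = f (r (x, y)).1 * f (r (x, y)).2) →
      ∃! φ : B → H, (∀ a b, φ (S.mul a b) = φ a * φ b) ∧ ∀ x, φ (ι x) = f x) ∧
  ∀ x y, S.braceR (ι x, ι y) = (ι (r (x, y)).1, ι (r (x, y)).2)

/-- The set of conjugates of `x` in the skew brace `B`: all elements of the form
`g ∗ x`, `x ∗ g`, `g ∘ x ∘ g⁻¹` and `g + x - g`, with `g ∈ B`. -/
def SkewBrace.conjugates {B : Type u} (S : SkewBrace B) (x : B) : Set B :=
  (Set.range fun g => S.star g x) ∪ (Set.range fun g => S.star x g) ∪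
    (Set.range fun g => S.mul (S.mul g x) (S.inv g)) ∪
    Set.range fun g => S.add (S.add g x) (S.neg g)

namespace Subgroup

theorem FG.of_le_of_commute {G : Type*} [Group G] {H K : Subgroup G} (hK : K.FG)
    (hcomm : ∀ a ∈ K, ∀ b ∈ K, a * b = b * a) (hHK : H ≤ K) : H.FG := by
  let _ : CommGroup K :=
    { (inferInstance : Group K) with
      mul_comm := fun a b => Subtype.ext (hcomm a a.2 b b.2) }
  have : Group.FG K := (Group.fg_iff_subgroup_fg K).mpr hK
  have : Module.Finite ℤ (Additive K) := Module.Finite.iff_addGroup_fg.mpr inferInstance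
  have hfg : (H.subgroupOf K).FG := by
    rw [Subgroup.fg_iff_add_fg]
    have := IsNoetherian.noetherian
      (AddSubgroup.toIntSubmodule (Subgroup.toAddSubgroup (H.subgroupOf K)))
    rw [Submodule.fg_iff_addSubgroup_fg] at this
    exact this
  have : Group.FG (H.subgroupOf K) := (Group.fg_iff_subgroup_fg _).mpr hfg
  exact (Group.fg_iff_subgroup_fg H).mp
    (Group.fg_of_surjective (f := (Subgroup.subgroupOfEquivOfLe hHK).toMonoidHom)
      (Subgroup.subgroupOfEquivOfLe hHK).surjective)

end Subgroup

open scoped commutatorElement in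
/-- A group that is finitely generated and virtually abelian is finitely presented. -/
theorem Group.IsFinitelyPresented.of_finiteIndex_of_commute {G : Type*} [Group G] [Group.FG G]
    (A : Subgroup G) [A.FiniteIndex] (hcomm : ∀ a ∈ A, ∀ b ∈ A, a * b = b * a) :
    Group.IsFinitelyPresented G := by
  obtain ⟨α, _, φ, hφ⟩ := Group.fg_iff_exists_freeGroup_hom_surjective_finite.mp ‹Group.FG G›
  refine Group.IsFinitelyPresented.of_surjective φ hφ ?_
  have hP : (A.comap φ).FiniteIndex :=
    ⟨by rw [A.index_comap_of_surjective hφ]; exact Subgroup.FiniteIndex.index_ne_zero⟩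
  have hfgP : Group.FG (A.comap φ) := inferInstance
  obtain ⟨X, hX, hXfin⟩ := (Subgroup.fg_iff _).mp ((Group.fg_iff_subgroup_fg _).mp hfgP)
  set N := Subgroup.normalClosure (Set.image2 (fun x y => ⁅x, y⁆) X X) with hN
  have hNK : N ≤ φ.ker := by
    refine Subgroup.normalClosure_le_normal ?_
    rintro _ ⟨x, hx, y, hy, rfl⟩
    have hmem : ∀ z ∈ X, φ z ∈ A := fun z hz => by
      have : z ∈ A.comap φ := hX ▸ Subgroup.subset_closure hz
      exact this
    change φ ⁅x, y⁆ = 1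
    rw [map_commutatorElement, commutatorElement_eq_one_iff_mul_comm]
    exact hcomm _ (hmem x hx) _ (hmem y hy)
  have hmap : (A.comap φ).map (QuotientGroup.mk' N) =
      Subgroup.closure (QuotientGroup.mk' N '' X) := by
    rw [← hX, MonoidHom.map_closure]
  have hcommN : ∀ a ∈ (A.comap φ).map (QuotientGroup.mk' N),
      ∀ b ∈ (A.comap φ).map (QuotientGroup.mk' N), a * b = b * a := by
    rw [hmap]
    have := Subgroup.isMulCommutative_closure (k := QuotientGroup.mk' N '' X) (by
      rintro _ ⟨x, hx, rfl⟩ _ ⟨y, hy, rfl⟩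
      rw [← commutatorElement_eq_one_iff_mul_comm, ← map_commutatorElement]
      exact (QuotientGroup.eq_one_iff _).mpr
        (Subgroup.subset_normalClosure ⟨x, hx, y, hy, rfl⟩))
    intro a ha b hb
    exact congrArg Subtype.val (this.is_comm.comm ⟨a, ha⟩ ⟨b, hb⟩)
  have hfg : (φ.ker.map (QuotientGroup.mk' N)).FG :=
    Subgroup.FG.of_le_of_commute
      ((Subgroup.fg_iff _).mpr ⟨_, hmap.symm, hXfin.image _⟩) hcommN
      (Subgroup.map_mono (MonoidHom.ker_le_comap φ A))
  have : (φ.ker.map (QuotientGroup.mk' N)).Normal :=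
    Subgroup.Normal.map inferInstance _ (QuotientGroup.mk'_surjective N)
  have : Group.FG (φ.ker.map (QuotientGroup.mk' N)) := (Group.fg_iff_subgroup_fg _).mpr hfg
  have key := (Subgroup.IsFinitelyNormallyGenerated.of_FG
    (φ.ker.map (QuotientGroup.mk' N))).comap (QuotientGroup.mk'_surjective N)
    (by rw [QuotientGroup.ker_mk']; exact ⟨_, hXfin.image2 _ hXfin, rfl⟩)
  rwa [Subgroup.comap_map_eq, QuotientGroup.ker_mk', sup_eq_left.mpr hNK] at key

/-- A group covered by finitely many cosets of a finitely generated abelian subgroup is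
finitely presented. -/
theorem Group.IsFinitelyPresented.of_cosets {G : Type*} [Group G] (A : Subgroup G) {E T : Set G}
    (hE : E.Finite) (hAE : Subgroup.closure E = A) (hcomm : ∀ a ∈ A, ∀ b ∈ A, a * b = b * a)
    (hT : T.Finite) (hcover : ∀ g, ∃ t ∈ T, ∃ a ∈ A, g = t * a) :
    Group.IsFinitelyPresented G := by
  have : Group.FG G := by
    refine Group.fg_iff.mpr ⟨T ∪ E, ?_, hT.union hE⟩
    refine eq_top_iff.mpr fun g _ => ?_
    obtain ⟨t, ht, a, ha, rfl⟩ := hcover g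
    exact mul_mem (Subgroup.subset_closure (Or.inl ht))
      (Subgroup.closure_mono Set.subset_union_right (hAE ▸ ha))
  have : Finite (G ⧸ A) := by
    refine Set.finite_univ_iff.mp ((hT.image (QuotientGroup.mk : G → G ⧸ A)).subset ?_)
    rintro q -
    induction q using QuotientGroup.induction_on with
    | H g =>
      obtain ⟨t, ht, a, ha, rfl⟩ := hcover g
      exact ⟨t, ht, (QuotientGroup.mk_mul_of_mem t ha).symm⟩
  have := A.finiteIndex_of_finite_quotient
  exact .of_finiteIndex_of_commute A hcomm

namespace SkewBrace

section

variable {B : Type u} (S : SkewBrace B)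

/-- The group `(B,+)`, written multiplicatively. -/
abbrev addGroup : Group B where
  mul := S.add
  one := S.zero
  inv := S.neg
  mul_assoc := S.add_assoc
  one_mul := S.zero_add
  mul_one := S.add_zero
  inv_mul_cancel := S.neg_add

/-- The group `(B,∘)`. -/
abbrev mulGroup : Group B where
  mul := S.mul
  one := S.zero
  inv := S.inv
  mul_assoc := S.mul_assoc
  one_mul := S.zero_mul
  mul_one := S.mul_zero
  inv_mul_cancel := S.inv_mul

theorem neg_add_cancel_left (a b : B) : S.add (S.neg a) (S.add a b) = b := by
  rw [← S.add_assoc, S.neg_add, S.zero_add]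

theorem add_neg_cancel_left (a b : B) : S.add a (S.add (S.neg a) b) = b := by
  rw [← S.add_assoc, S.add_neg, S.zero_add]

theorem add_neg_cancel_right (a b : B) : S.add (S.add a b) (S.neg b) = a := by
  rw [S.add_assoc, S.add_neg, S.add_zero]

theorem add_left_cancel {a b c : B} (h : S.add a b = S.add a c) : b = c := by
  rw [← S.neg_add_cancel_left a b, h, S.neg_add_cancel_left]

theorem mul_eq_add_lam (a b : B) : S.mul a b = S.add a (S.lam a b) :=
  (S.add_neg_cancel_left a _).symm

theorem lam_add (a b c : B) : S.lam a (S.add b c) = S.add (S.lam a b) (S.lam a c) := by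
  simp only [lam, S.compat, S.add_assoc]

theorem mul_add (a b c : B) : S.mul a (S.add b c) = S.add (S.mul a b) (S.lam a c) := by
  rw [S.compat, lam, S.add_assoc]

theorem lam_mul (a b c : B) : S.lam (S.mul a b) c = S.lam a (S.lam b c) := by
  apply S.add_left_cancel (a := S.mul a b)
  rw [← S.mul_eq_add_lam, S.mul_assoc, ← S.mul_add, ← S.mul_eq_add_lam]

theorem zero_lam (b : B) : S.lam S.zero b = b := by
  apply S.add_left_cancel (a := S.zero)
  rw [← S.mul_eq_add_lam, S.zero_mul, S.zero_add]

theorem lam_zero (a : B) : S.lam a S.zero = S.zero := by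
  rw [lam, S.mul_zero, S.neg_add]

theorem lam_lam_inv (a b : B) : S.lam a (S.lam (S.inv a) b) = b := by
  rw [← S.lam_mul, S.mul_inv, S.zero_lam]

theorem neg_eq_of_add_eq_zero {a b : B} (h : S.add a b = S.zero) : S.neg a = b :=
  S.add_left_cancel (a := a) (by rw [S.add_neg, h])

theorem inv_eq_of_mul_eq_zero {a b : B} (h : S.mul a b = S.zero) : S.inv a = b := by
  rw [← S.mul_zero (S.inv a), ← h, ← S.mul_assoc, S.inv_mul, S.zero_mul]

theorem lam_neg (a b : B) : S.lam a (S.neg b) = S.neg (S.lam a b) :=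
  (S.neg_eq_of_add_eq_zero (by rw [← S.lam_add, S.add_neg, S.lam_zero])).symm

theorem add_eq_mul_lam_inv (a b : B) : S.add a b = S.mul a (S.lam (S.inv a) b) := by
  rw [S.mul_eq_add_lam, S.lam_lam_inv]

theorem mul_eq_add_of_mem_soc {x : B} (hx : x ∈ S.soc) (b : B) : S.mul x b = S.add x b := by
  rw [S.mul_eq_add_lam, hx.1]

/-- Conjugation by `g` in `(B,∘)` acts on the socle as `λ_g`. -/
theorem conj_eq_lam_of_mem_soc {x : B} (hx : x ∈ S.soc) (g : B) :
    S.mul (S.mul g x) (S.inv g) = S.lam g x := by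
  rw [S.mul_assoc, S.mul_eq_add_of_mem_soc hx, hx.2, S.mul_add, S.mul_inv, S.zero_add]

theorem lam_mem_soc {x : B} (hx : x ∈ S.soc) (g : B) : S.lam g x ∈ S.soc := by
  refine ⟨fun b => ?_, fun b => ?_⟩
  · rw [← S.conj_eq_lam_of_mem_soc hx, S.lam_mul, S.lam_mul, hx.1, S.lam_lam_inv]
  · rw [← S.lam_lam_inv g b, ← S.lam_add, hx.2, S.lam_add]

theorem lam_add_of_mem_soc {x : B} (hx : x ∈ S.soc) (t b : B) :
    S.lam (S.add t x) b = S.lam t b := by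
  rw [S.add_eq_mul_lam_inv, S.lam_mul, (S.lam_mem_soc hx _).1]

theorem isAddSubgroup_soc : S.IsAddSubgroup S.soc := by
  refine ⟨⟨S.zero_lam, fun b => by rw [S.zero_add, S.add_zero]⟩, fun a ha b hb => ⟨fun c => ?_,
    fun c => ?_⟩, fun a ha => ?_⟩
  · rw [S.lam_add_of_mem_soc hb, ha.1]
  · rw [S.add_assoc, hb.2, ← S.add_assoc, ha.2, S.add_assoc]
  · have hcomm : ∀ b, S.add (S.neg a) b = S.add b (S.neg a) := fun b => by
      apply S.add_left_cancel (a := a)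
      rw [S.add_neg_cancel_left, ← S.add_assoc, ha.2, S.add_neg_cancel_right]
    refine ⟨fun b => ?_, hcomm⟩
    have h := S.lam_add_of_mem_soc ha (S.neg a) b
    rw [S.neg_add, S.zero_lam] at h
    exact h.symm

theorem inv_eq_neg_of_mem_soc {x : B} (hx : x ∈ S.soc) : S.inv x = S.neg x :=
  S.inv_eq_of_mul_eq_zero (by rw [S.mul_eq_add_of_mem_soc hx, S.add_neg])

theorem subset_addClosure (X : Set B) : X ⊆ S.addClosure X :=
  Set.subset_sInter fun _ h => h.2

theorem isAddSubgroup_addClosure (X : Set B) : S.IsAddSubgroup (S.addClosure X) :=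
  ⟨fun _ h => h.1.1, fun a ha b hb T h => h.1.2.1 a (ha T h) b (hb T h),
    fun a ha T h => h.1.2.2 a (ha T h)⟩

theorem addClosure_subset {X T : Set B} (hT : S.IsAddSubgroup T) (h : X ⊆ T) :
    S.addClosure X ⊆ T :=
  Set.sInter_subset_of_mem ⟨hT, h⟩

variable {S} {E T : Set B}

theorem lam_mem_addClosure (hE : ∀ g, ∀ e ∈ E, S.lam g e ∈ E) (g : B) {a : B}
    (ha : a ∈ S.addClosure E) : S.lam g a ∈ S.addClosure E := by
  have hM := S.isAddSubgroup_addClosure E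
  refine S.addClosure_subset (T := {a | S.lam g a ∈ S.addClosure E}) ⟨?_, ?_, ?_⟩
    (fun e he => S.subset_addClosure E (hE g e he)) ha
  · simpa only [Set.mem_ofPred_eq, S.lam_zero] using hM.1
  · intro a ha b hb
    simpa only [Set.mem_ofPred_eq, S.lam_add] using hM.2.1 _ ha _ hb
  · intro a ha
    simpa only [Set.mem_ofPred_eq, S.lam_neg] using hM.2.2 _ ha

theorem isIdeal_of_subset_soc {I : Set B} (hI : S.IsAddSubgroup I) (hsoc : I ⊆ S.soc)
    (hlam : ∀ g, ∀ a ∈ I, S.lam g a ∈ I) : S.IsIdeal I := by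
  refine ⟨hI, fun b a ha => ?_, fun b a ha => ?_, hlam⟩
  · rwa [← (hsoc ha).2, S.add_neg_cancel_right]
  · rw [S.conj_eq_lam_of_mem_soc (hsoc ha)]
    exact hlam b a ha

theorem isSub_of_subset_soc {I : Set B} (hI : S.IsAddSubgroup I) (hsoc : I ⊆ S.soc) :
    S.IsSub I := by
  refine ⟨hI.1, hI.2.1, hI.2.2, fun a ha b hb => ?_, fun a ha => ?_⟩
  · rw [S.mul_eq_add_of_mem_soc (hsoc ha)]
    exact hI.2.1 a ha b hb
  · rw [S.inv_eq_neg_of_mem_soc (hsoc ha)]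
    exact hI.2.2 a ha

theorem subGen_eq_addClosure (hE : E ⊆ S.soc) : S.subGen E = S.addClosure E :=
  Set.Subset.antisymm
    (Set.sInter_subset_of_mem ⟨isSub_of_subset_soc (S.isAddSubgroup_addClosure E)
      (S.addClosure_subset S.isAddSubgroup_soc hE), S.subset_addClosure E⟩)
    (Set.subset_sInter fun _ h => S.addClosure_subset ⟨h.1.1, h.1.2.1, h.1.2.2.1⟩ h.2)

theorem finite_range_lam (hT : T.Finite) (hcover : ∀ b, ∃ t ∈ T, ∃ x ∈ S.soc, b = S.add t x)
    (a : B) : (Set.range fun g => S.lam g a).Finite := by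
  refine (hT.image fun t => S.lam t a).subset ?_
  rintro _ ⟨g, rfl⟩
  obtain ⟨t, ht, x, hx, rfl⟩ := hcover g
  exact ⟨t, ht, (S.lam_add_of_mem_soc hx t a).symm⟩

theorem finite_conjugates (hlam : ∀ a, (Set.range fun g => S.lam g a).Finite) {x : B}
    (hx : x ∈ S.soc) : (S.conjugates x).Finite := by
  refine (((?_ : Set.Finite _).union ?_).union ?_).union ?_
  · refine ((hlam x).image fun y => S.add y (S.neg x)).subset ?_
    rintro _ ⟨g, rfl⟩
    exact ⟨_, ⟨g, rfl⟩, rfl⟩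
  · refine (Set.finite_singleton S.zero).subset ?_
    rintro _ ⟨g, rfl⟩
    change S.add (S.lam x g) (S.neg g) = S.zero
    rw [hx.1, S.add_neg]
  · simpa only [S.conj_eq_lam_of_mem_soc hx] using hlam x
  · refine (Set.finite_singleton x).subset ?_
    rintro _ ⟨g, rfl⟩
    change S.add (S.add g x) (S.neg g) = x
    rw [← hx.2, S.add_neg_cancel_right]

/-- If the socle has finite index in a finitely generated skew brace, then it contains a finite
`λ`-invariant set whose additive span has finite index. -/
theorem exists_finite_subset_soc (hfg : S.FinitelyGenerated) (hT : T.Finite)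
    (hcover : ∀ b, ∃ t ∈ T, ∃ x ∈ S.soc, b = S.add t x) :
    ∃ E : Set B, E.Finite ∧ E ⊆ S.soc ∧ (∀ g, ∀ e ∈ E, S.lam g e ∈ E) ∧
      ∀ b, ∃ t ∈ T, ∃ a ∈ S.addClosure E, b = S.add t a := by
  obtain ⟨X, hX⟩ := hfg
  choose r hrT s hs hrs using hcover
  set Y : Set B := {S.zero} ∪ X ∪ Set.image2 S.add T T ∪ S.neg '' T ∪ Set.image2 S.mul T T ∪
    S.inv '' T with hY
  have hYfin : Y.Finite :=
    (((((Set.finite_singleton _).union X.finite_toSet).union (hT.image2 _ hT)).union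
      (hT.image _)).union (hT.image2 _ hT)).union (hT.image _)
  set E : Set B := ⋃ y ∈ Y, Set.range fun g => S.lam g (s y) with hEdef
  have hElam : ∀ g, ∀ e ∈ E, S.lam g e ∈ E := by
    intro g e he
    simp only [hEdef, Set.mem_iUnion] at he ⊢
    obtain ⟨y, hy, h, rfl⟩ := he
    exact ⟨y, hy, S.mul g h, S.lam_mul g h _⟩
  have hEsoc : E ⊆ S.soc := by
    intro e he
    simp only [hEdef, Set.mem_iUnion] at he
    obtain ⟨y, hy, h, rfl⟩ := he
    exact S.lam_mem_soc (hs y) h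
  refine ⟨E, hYfin.biUnion fun y _ =>
    finite_range_lam hT (fun b => ⟨r b, hrT b, s b, hs b, hrs b⟩) _, hEsoc, hElam, ?_⟩
  have hM := S.isAddSubgroup_addClosure E
  have hMsoc : S.addClosure E ⊆ S.soc := S.addClosure_subset S.isAddSubgroup_soc hEsoc
  set W : Set B := {b | ∃ t ∈ T, ∃ a ∈ S.addClosure E, b = S.add t a} with hW
  have hYW : ∀ y ∈ Y, ∀ a ∈ S.addClosure E, S.add y a ∈ W := by
    intro y hy a ha
    refine ⟨r y, hrT y, _, hM.2.1 (s y) (S.subset_addClosure E ?_) a ha, ?_⟩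
    · simp only [hEdef, Set.mem_iUnion]
      exact ⟨y, hy, S.zero, S.zero_lam _⟩
    · rw [← S.add_assoc, ← hrs y]
  have hYW' : ∀ y ∈ Y, y ∈ W := fun y hy => by
    simpa only [S.add_zero] using hYW y hy S.zero hM.1
  have hsub : S.IsSub W := by
    refine ⟨hYW' _ (by simp [hY]), ?_, ?_, ?_, ?_⟩
    · rintro _ ⟨t, ht, a, ha, rfl⟩ _ ⟨t', ht', a', ha', rfl⟩
      have : S.add (S.add t a) (S.add t' a') = S.add (S.add t t') (S.add a a') := by
        rw [S.add_assoc, ← S.add_assoc a, (hMsoc ha).2 t', S.add_assoc, S.add_assoc]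
      rw [this]
      refine hYW _ ?_ _ (hM.2.1 a ha a' ha')
      simp only [hY, Set.mem_union]
      exact Or.inl (Or.inl (Or.inl (Or.inr ⟨t, ht, t', ht', rfl⟩)))
    · rintro _ ⟨t, ht, a, ha, rfl⟩
      have : S.neg (S.add t a) = S.add (S.neg t) (S.neg a) := by
        apply S.neg_eq_of_add_eq_zero
        rw [(hMsoc ha).2 t |>.symm, S.add_assoc, S.add_neg_cancel_left, S.add_neg]
      rw [this]
      refine hYW _ ?_ _ (hM.2.2 a ha)
      simp only [hY, Set.mem_union]
      exact Or.inl (Or.inl (Or.inr ⟨t, ht, rfl⟩))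
    · rintro _ ⟨t, ht, a, ha, rfl⟩ _ ⟨t', ht', a', ha', rfl⟩
      have : S.mul (S.add t a) (S.add t' a') = S.add (S.mul t t') (S.add a (S.lam t a')) := by
        rw [S.mul_add, S.mul_eq_add_lam (S.add t a), S.lam_add_of_mem_soc (hMsoc ha),
          S.lam_add_of_mem_soc (hMsoc ha), S.add_assoc t a, (hMsoc ha).2, ← S.add_assoc t,
          ← S.mul_eq_add_lam, S.add_assoc]
      rw [this]
      refine hYW _ ?_ _ (hM.2.1 a ha _ (lam_mem_addClosure hElam t ha'))
      simp only [hY, Set.mem_union]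
      exact Or.inl (Or.inr ⟨t, ht, t', ht', rfl⟩)
    · rintro _ ⟨t, ht, a, ha, rfl⟩
      have : S.inv (S.add t a) = S.add (S.inv t) (S.lam (S.inv t) (S.neg a)) := by
        apply S.inv_eq_of_mul_eq_zero
        rw [S.mul_add, S.mul_eq_add_lam (S.add t a), S.lam_add_of_mem_soc (hMsoc ha),
          S.lam_add_of_mem_soc (hMsoc ha), S.lam_lam_inv, S.add_assoc t a, (hMsoc ha).2,
          ← S.add_assoc t, ← S.mul_eq_add_lam, S.mul_inv, S.zero_add, S.add_neg]
      rw [this]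
      refine hYW _ ?_ _ (lam_mem_addClosure hElam _ (hM.2.2 a ha))
      simp only [hY, Set.mem_union]
      exact Or.inr ⟨t, ht, rfl⟩
  have hXW : (X : Set B) ⊆ W := fun x hx => hYW' x (by simp [hY, Finset.mem_coe.mp hx])
  intro b
  have hb : b ∈ S.subGen X := hX ▸ Set.mem_univ b
  exact hb W ⟨hsub, hXW⟩

theorem AddFP.of_isFinitelyPresented
    (h : @Group.IsFinitelyPresented B S.addGroup) : S.AddFP := by
  let _ := S.addGroup
  obtain ⟨n, φ, hφ, R, hR, hker⟩ := h
  exact ⟨n, φ, φ.map_mul, hφ, hR.toFinset, by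
    rw [hR.coe_toFinset, hker]; rfl⟩

theorem MulFP.of_isFinitelyPresented
    (h : @Group.IsFinitelyPresented B S.mulGroup) : S.MulFP := by
  let _ := S.mulGroup
  obtain ⟨n, φ, hφ, R, hR, hker⟩ := h
  exact ⟨n, φ, φ.map_mul, hφ, hR.toFinset, by
    rw [hR.coe_toFinset, hker]; rfl⟩

theorem addFP_of_cosets (hE : E.Finite) (hEsoc : E ⊆ S.soc) (hT : T.Finite)
    (hcover : ∀ b, ∃ t ∈ T, ∃ a ∈ S.addClosure E, b = S.add t a) : S.AddFP := by
  apply AddFP.of_isFinitelyPresented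
  let _ := S.addGroup
  have hsub : S.addClosure E ⊆ (Subgroup.closure E : Set B) :=
    S.addClosure_subset ⟨one_mem (Subgroup.closure E),
      fun _ ha _ hb => mul_mem (S := Subgroup B) ha hb,
      fun _ ha => inv_mem (S := Subgroup B) ha⟩ Subgroup.subset_closure
  refine Group.IsFinitelyPresented.of_cosets (Subgroup.closure E) hE rfl ?_ hT fun b => ?_
  · have hle : Subgroup.closure E ≤ Subgroup.center B :=
      (Subgroup.closure_le _).mpr fun e he =>
        Subgroup.mem_center_iff.mpr fun g => ((hEsoc he).2 g).symm
    exact fun a _ b hb => Subgroup.mem_center_iff.mp (hle hb) a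
  · obtain ⟨t, ht, a, ha, h⟩ := hcover b
    exact ⟨t, ht, a, hsub ha, h⟩

theorem mulFP_of_cosets (hE : E.Finite) (hEsoc : E ⊆ S.soc)
    (hlam : ∀ g, ∀ e ∈ E, S.lam g e ∈ E) (hT : T.Finite)
    (hcover : ∀ b, ∃ t ∈ T, ∃ a ∈ S.addClosure E, b = S.add t a) : S.MulFP := by
  apply MulFP.of_isFinitelyPresented
  have hM := S.isAddSubgroup_addClosure E
  have hMsoc : S.addClosure E ⊆ S.soc := S.addClosure_subset S.isAddSubgroup_soc hEsoc
  have hMsub := isSub_of_subset_soc hM hMsoc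
  let _ := S.mulGroup
  let M : Subgroup B :=
    { carrier := S.addClosure E
      mul_mem' := fun {a b} ha hb => hMsub.2.2.2.1 a ha b hb
      one_mem' := hM.1
      inv_mem' := fun {a} ha => hMsub.2.2.2.2 a ha }
  have hle : Subgroup.closure E ≤ M := (Subgroup.closure_le _).mpr (S.subset_addClosure E)
  have hadd : S.IsAddSubgroup (Subgroup.closure E : Set B) := by
    refine ⟨one_mem (Subgroup.closure E), fun a ha b hb => ?_, fun a ha => ?_⟩
    · rw [← S.mul_eq_add_of_mem_soc (hMsoc (hle ha))]
      exact mul_mem (S := Subgroup B) ha hb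
    · rw [← S.inv_eq_neg_of_mem_soc (hMsoc (hle ha))]
      exact inv_mem (S := Subgroup B) ha
  refine Group.IsFinitelyPresented.of_cosets M hE
    (le_antisymm hle (S.addClosure_subset hadd Subgroup.subset_closure)) ?_ hT fun b => ?_
  · intro a ha b hb
    change S.mul a b = S.mul b a
    rw [S.mul_eq_add_of_mem_soc (hMsoc ha), S.mul_eq_add_of_mem_soc (hMsoc hb), (hMsoc ha).2]
  · obtain ⟨t, ht, a, ha, h⟩ := hcover b
    exact ⟨t, ht, _, lam_mem_addClosure hlam (S.inv t) ha, h.trans (S.add_eq_mul_lam_inv t a)⟩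

theorem exists_finite_transversal_soc
    (hsoc : (Set.range fun b => S.add b '' S.soc).Finite) :
    ∃ T : Set B, T.Finite ∧ ∀ b, ∃ t ∈ T, ∃ x ∈ S.soc, b = S.add t x := by
  have := hsoc.to_subtype
  refine ⟨_, Set.finite_range (Set.rangeSplitting fun b => S.add b '' S.soc), fun b => ?_⟩
  have h := Set.apply_rangeSplitting (fun b => S.add b '' S.soc) ⟨_, b, rfl⟩
  have hb : b ∈ S.add b '' S.soc := ⟨S.zero, S.isAddSubgroup_soc.1, S.add_zero b⟩
  obtain ⟨x, hx, hxb⟩ := h.symm.subset hb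
  exact ⟨_, ⟨_, rfl⟩, x, hx, hxb.symm⟩

theorem finite_range_coset {I : Set B} (hI : S.IsAddSubgroup I) (hT : T.Finite)
    (hcover : ∀ b, ∃ t ∈ T, ∃ a ∈ I, b = S.add t a) :
    (Set.range fun b => S.add b '' I).Finite := by
  refine (hT.image fun t => S.add t '' I).subset ?_
  rintro _ ⟨b, rfl⟩
  obtain ⟨t, ht, a, ha, rfl⟩ := hcover b
  refine ⟨t, ht, Set.Subset.antisymm ?_ ?_⟩
  · rintro _ ⟨c, hc, rfl⟩
    exact ⟨S.add (S.neg a) c, hI.2.1 _ (hI.2.2 a ha) c hc, by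
      rw [S.add_assoc, S.add_neg_cancel_left]⟩
  · rintro _ ⟨c, hc, rfl⟩
    exact ⟨S.add a c, hI.2.1 a ha c hc, (S.add_assoc t a c).symm⟩

end

end SkewBrace

/-- **Theorem.** Let `B` be a finitely generated skew brace such that `B/Soc(B)` is
finite and `(B,∘)` is virtually abelian. Then `B` contains an ideal `I` such that:
(1) `I` is a finitely generated trivial brace; (2) `I ⊆ Soc(B)`; (3) `B/I` is finite;
(4) every element of `I` has only finitely many conjugates in `B`. In particular,
the groups `(B,+)` and `(B,∘)` are finitely presented. -/
theorem exists_good_ideal {B : Type u} (S : SkewBrace B)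
    (hfg : S.FinitelyGenerated)
    (hsoc : (Set.range fun b => S.add b '' S.soc).Finite)
    (hva : ∃ A : Set B, S.IsMulSubgroup A ∧ (∀ a ∈ A, ∀ b ∈ A, S.mul a b = S.mul b a) ∧
      (Set.range fun b => S.mul b '' A).Finite) :
    (∃ I : Set B, S.IsIdeal I ∧
      -- (1) I is a trivial brace ...
      (∀ a ∈ I, ∀ b ∈ I, S.mul a b = S.add a b) ∧
      (∀ a ∈ I, ∀ b ∈ I, S.add a b = S.add b a) ∧
      -- ... which is finitely generated
      (∃ T : Finset B, ↑T ⊆ I ∧ S.subGen ↑T = I) ∧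
      -- (2) I is contained in Soc(B)
      I ⊆ S.soc ∧
      -- (3) B/I is finite
      (Set.range fun b => S.add b '' I).Finite ∧
      -- (4) every element of I has finitely many conjugates in B
      ∀ x ∈ I, (S.conjugates x).Finite) ∧
    S.AddFP ∧ S.MulFP := by
  obtain ⟨T, hT, hcover⟩ := SkewBrace.exists_finite_transversal_soc hsoc
  obtain ⟨E, hE, hEsoc, hElam, hEcover⟩ := SkewBrace.exists_finite_subset_soc hfg hT hcover
  have hI := S.isAddSubgroup_addClosure E
  have hIsoc : S.addClosure E ⊆ S.soc := S.addClosure_subset S.isAddSubgroup_soc hEsoc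
  refine ⟨⟨S.addClosure E, ?_, ?_, ?_, ?_, hIsoc, ?_, ?_⟩, ?_, ?_⟩
  · exact SkewBrace.isIdeal_of_subset_soc hI hIsoc
      fun g _ ha => SkewBrace.lam_mem_addClosure hElam g ha
  · exact fun a ha b _ => S.mul_eq_add_of_mem_soc (hIsoc ha) b
  · exact fun a ha b _ => (hIsoc ha).2 b
  · refine ⟨hE.toFinset, ?_, ?_⟩
    · rw [hE.coe_toFinset]
      exact S.subset_addClosure E
    · rw [hE.coe_toFinset]
      exact SkewBrace.subGen_eq_addClosure hEsoc
  · exact SkewBrace.finite_range_coset hI hT hEcover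
  · exact fun x hx =>
      SkewBrace.finite_conjugates (SkewBrace.finite_range_lam hT hcover) (hIsoc hx)
  · exact SkewBrace.addFP_of_cosets hE hEsoc hT hEcover
  · exact SkewBrace.mulFP_of_cosets hE hEsoc hElam hT hEcover
end

section
/- Let (X,r) be a finite non-degenerate set-theoretic solution of the Yang–Baxter equation and let B = G(X,r) be its structure skew brace. Then B/Soc(B) is a finite skew brace and the additive group (B,+) is central-by-finite (its center has finite index). -/
universe u v

section AddGroup

variable {B : Type u} [AddGroup B]

open scoped Pointwise in
theorem addConj_mem {Y : Set B} (hY : Y.Finite) (hgen : AddSubgroup.closure Y = ⊤)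
    (hconj : ∀ x ∈ Y, ∀ y ∈ Y, -y + x + y ∈ Y) (a : B) {y : B} (hy : y ∈ Y) :
    a + y + -a ∈ Y := by
  let c : B →+ Additive (Equiv.Perm B) := (AddAut.toPerm B).comp AddAut.addConj
  have : AddSubgroup.closure Y ≤
      (MulAction.stabilizer (Equiv.Perm B) Y).toAddSubgroup.comap c := by
    refine (AddSubgroup.closure_le _).2 fun x hx => ?_
    rw [SetLike.mem_coe, ← neg_mem_iff]
    refine (MulAction.mem_stabilizer_set' hY).2 fun y hy => ?_
    have hxy : -x + y + - -x ∈ Y := by simpa using hconj y hy x hx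
    exact hxy
  have ha : a ∈ AddSubgroup.closure Y := hgen ▸ AddSubgroup.mem_top a
  exact (MulAction.mem_stabilizer_set' hY).1 (this ha) hy

/-- An element commuting with additive generators is additively central. -/
theorem addCommute_of_closure {Y : Set B} (hgen : AddSubgroup.closure Y = ⊤) {z : B}
    (hz : ∀ y ∈ Y, z + y = y + z) (b : B) : z + b = b + z := by
  have : AddSubgroup.closure Y ≤ AddSubgroup.centralizer {z} :=
    (AddSubgroup.closure_le _).2 fun y hy =>
      AddSubgroup.mem_centralizer_singleton_iff.2 (hz y hy).symm
  exact (AddSubgroup.mem_centralizer_singleton_iff.1 (this (hgen ▸ AddSubgroup.mem_top b))).symm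

end AddGroup

section TwoGroupStructures

variable {B : Type u} [Group B] [AddGroup B]

/-- The common identity of the two group structures of a skew brace. -/
theorem zero_eq_one_of_compat (h : ∀ a b c : B, a * (b + c) = a * b + -a + a * c) :
    (0 : B) = 1 :=
  Eq.symm (by simpa using h 1 0 0)

/-- The homomorphism `a ↦ λ_a`, with `λ_a b = -a + a * b`, from the multiplicative group of a
skew brace to the permutations of its underlying set. -/
def lamPerm (h : ∀ a b c : B, a * (b + c) = a * b + -a + a * c) : B →* Equiv.Perm B :=
  have lam_mul : ∀ a b c : B, -(a * b) + a * b * c = -a + a * (-b + b * c) := fun a b c => by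
    have h₁ := h a (-b) b
    rw [neg_add_cancel, zero_eq_one_of_compat h, mul_one] at h₁
    have h₂ : a * -b = a + -(a * b) + a := by
      rwa [eq_comm, ← eq_add_neg_iff_add_eq, ← eq_add_neg_iff_add_eq, neg_neg] at h₁
    simp [h a (-b), h₂, add_assoc, mul_assoc]
  have lam_one : ∀ b : B, -(1 : B) + 1 * b = b := fun b => by
    simp [← zero_eq_one_of_compat h]
  { toFun := fun a =>
      { toFun := fun b => -a + a * b
        invFun := fun b => -a⁻¹ + a⁻¹ * b
        left_inv := fun b => by
          simpa only [inv_mul_cancel, lam_one] using (lam_mul a⁻¹ a b).symm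
        right_inv := fun b => by
          simpa only [mul_inv_cancel, lam_one] using (lam_mul a a⁻¹ b).symm }
    map_one' := Equiv.ext lam_one
    map_mul' := fun a b => Equiv.ext (lam_mul a b) }

variable (h : ∀ a b c : B, a * (b + c) = a * b + -a + a * c)

theorem lamPerm_apply (a b : B) : lamPerm h a b = -a + a * b := rfl

theorem mul_eq_add_lamPerm (a b : B) : a * b = a + lamPerm h a b := by
  simp [lamPerm_apply]

theorem lamPerm_add (a b c : B) : lamPerm h a (b + c) = lamPerm h a b + lamPerm h a c := by
  simp [lamPerm_apply, h, add_assoc]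

theorem lamPerm_zero (a : B) : lamPerm h a 0 = 0 := by
  simpa using lamPerm_add h a 0 0

theorem lamPerm_neg (a b : B) : lamPerm h a (-b) = -lamPerm h a b :=
  eq_neg_of_add_eq_zero_left (by rw [← lamPerm_add, neg_add_cancel, lamPerm_zero])

theorem lamPerm_inv_self (a : B) : lamPerm h a⁻¹ a = -a⁻¹ := by
  rw [lamPerm_apply, inv_mul_cancel, ← zero_eq_one_of_compat h, add_zero]

open scoped Pointwise in
theorem lamPerm_mem_stabilizer {Y : Set B} (hY : Y.Finite) (hgen : Subgroup.closure Y = ⊤)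
    (hlam : ∀ x ∈ Y, ∀ y ∈ Y, lamPerm h x y ∈ Y) (a : B) :
    lamPerm h a ∈ MulAction.stabilizer (Equiv.Perm B) Y := by
  have : Subgroup.closure Y ≤ (MulAction.stabilizer (Equiv.Perm B) Y).comap (lamPerm h) := by
    refine (Subgroup.closure_le _).2 fun x hx => ?_
    exact (MulAction.mem_stabilizer_set' hY).2 fun y hy => hlam x hx y hy
  exact this (hgen ▸ Subgroup.mem_top a)

open scoped Pointwise in
theorem lamPerm_mem {Y : Set B} (hY : Y.Finite) (hgen : Subgroup.closure Y = ⊤)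
    (hlam : ∀ x ∈ Y, ∀ y ∈ Y, lamPerm h x y ∈ Y) (a : B) {y : B} (hy : y ∈ Y) :
    lamPerm h a y ∈ Y :=
  (MulAction.mem_stabilizer_set' hY).1 (lamPerm_mem_stabilizer h hY hgen hlam a) hy

/-- A finite set of multiplicative generators stable under the maps `λ_x` also generates the
additive group. -/
theorem addClosure_eq_top {Y : Set B} (hY : Y.Finite) (hgen : Subgroup.closure Y = ⊤)
    (hlam : ∀ x ∈ Y, ∀ y ∈ Y, lamPerm h x y ∈ Y) : AddSubgroup.closure Y = ⊤ := by
  have key (a b : B) (hb : b ∈ AddSubgroup.closure Y) :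
      lamPerm h a b ∈ AddSubgroup.closure Y := by
    induction hb using AddSubgroup.closure_induction with
    | mem y hy => exact AddSubgroup.subset_closure (lamPerm_mem h hY hgen hlam a hy)
    | zero => rw [lamPerm_zero]; exact zero_mem _
    | add b c _ _ hb hc => rw [lamPerm_add]; exact add_mem hb hc
    | neg b _ hb => rw [lamPerm_neg]; exact neg_mem hb
  refine (AddSubgroup.eq_top_iff' _).2 fun a => ?_
  have ha : a ∈ Subgroup.closure Y := hgen ▸ Subgroup.mem_top a
  induction ha using Subgroup.closure_induction with
  | mem y hy => exact AddSubgroup.subset_closure hy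
  | one => rw [← zero_eq_one_of_compat h]; exact zero_mem _
  | mul a b _ _ ha hb => rw [mul_eq_add_lamPerm h]; exact add_mem ha (key a b hb)
  | inv a _ ha => exact neg_mem_iff.1 (lamPerm_inv_self h a ▸ key a⁻¹ a ha)

theorem lamPerm_eq_of_closure {Y : Set B} (hgen : AddSubgroup.closure Y = ⊤) {a b : B}
    (hab : ∀ y ∈ Y, lamPerm h a y = lamPerm h b y) : lamPerm h a = lamPerm h b := by
  ext c
  have hc : c ∈ AddSubgroup.closure Y := hgen ▸ AddSubgroup.mem_top c
  induction hc using AddSubgroup.closure_induction with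
  | mem y hy => exact hab y hy
  | zero => simp only [lamPerm_zero]
  | add c d _ _ hc hd => simp only [lamPerm_add, hc, hd]
  | neg c _ hc => simp only [lamPerm_neg, hc]

/-- The kernel of `λ` on additively central elements is stable under every `λ_a`. -/
theorem lamPerm_lamPerm_eq_one {t : B} (ht : lamPerm h t = 1) (a : B)
    (hc : ∀ b, lamPerm h a t + b = b + lamPerm h a t) : lamPerm h (lamPerm h a t) = 1 := by
  have h₁ : lamPerm h a t = a * t * a⁻¹ := by
    have h₂ : a * t * a⁻¹ = a * (t + a⁻¹) := by
      rw [mul_assoc, mul_eq_add_lamPerm h t, ht, Equiv.Perm.one_apply]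
    rw [h₂, h, mul_inv_cancel, ← zero_eq_one_of_compat h, add_zero, mul_eq_add_lamPerm h, ← hc]
    simp
  rw [h₁, map_mul, map_mul, ht, mul_one, ← map_mul, mul_inv_cancel, map_one]

/-- Elements with equal `λ` that differ additively by a central element differ by an element of
the kernel of `λ`. -/
theorem lamPerm_neg_add_eq_one {b c : B} (hbc : lamPerm h b = lamPerm h c)
    (hz : ∀ d, -b + c + d = d + (-b + c)) : lamPerm h (-b + c) = 1 := by
  obtain ⟨t, ht⟩ := (lamPerm h b).surjective (-b + c)
  have hc : b * t = c := by rw [mul_eq_add_lamPerm h, ht, add_neg_cancel_left]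
  have ht₁ : lamPerm h t = 1 := by
    rw [← hc, map_mul] at hbc
    simpa using hbc.symm
  rw [← ht] at hz ⊢
  exact lamPerm_lamPerm_eq_one h ht₁ b hz

/-- Finitely many pairs of functions on `Y` control the maps `λ_b` and the additive
conjugations, so that some map to a finite type separates the cosets of the socle. -/
theorem exists_finite_separating {Y : Set B} (hY : Y.Finite) (hgen : Subgroup.closure Y = ⊤)
    (hlam : ∀ x ∈ Y, ∀ y ∈ Y, lamPerm h x y ∈ Y)
    (hconj : ∀ x ∈ Y, ∀ y ∈ Y, -y + x + y ∈ Y) :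
    ∃ (F : Type u) (_ : Finite F) (f : B → F), ∀ b c, f b = f c →
      lamPerm h (-b + c) = 1 ∧ ∀ d, -b + c + d = d + (-b + c) := by
  have hadd := addClosure_eq_top h hY hgen hlam
  have := hY.to_subtype
  refine ⟨(Y → Y) × (Y → Y), inferInstance, fun b =>
    (fun y => ⟨lamPerm h b y, lamPerm_mem h hY hgen hlam b y.2⟩,
      fun y => ⟨b + y + -b, addConj_mem hY hadd hconj b y.2⟩), fun b c hbc => ?_⟩
  simp only [Prod.mk.injEq, funext_iff, Subtype.mk.injEq, Subtype.forall] at hbc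
  have hz : ∀ d, -b + c + d = d + (-b + c) := addCommute_of_closure hadd fun y hy => by
    have hy' := hbc.2 y hy
    rw [← sub_eq_add_neg, sub_eq_iff_eq_add] at hy'
    rw [add_assoc, neg_add_eq_iff_eq_add, ← add_assoc, ← add_assoc, hy']
    simp [add_assoc]
  exact ⟨lamPerm_neg_add_eq_one h (lamPerm_eq_of_closure h hadd hbc.1) hz, hz⟩

end TwoGroupStructures

namespace SkewBrace

variable {B : Type u} (S : SkewBrace B)

/-- The multiplicative group of a skew brace. -/
abbrev toGroup : Group B where
  mul := S.mul
  one := S.zero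
  inv := S.inv
  mul_assoc := S.mul_assoc
  one_mul := S.zero_mul
  mul_one := S.mul_zero
  inv_mul_cancel := S.inv_mul

/-- The additive group of a skew brace. -/
abbrev toAddGroup : AddGroup B where
  add := S.add
  zero := S.zero
  neg := S.neg
  add_assoc := S.add_assoc
  zero_add := S.zero_add
  add_zero := S.add_zero
  neg_add_cancel := S.neg_add
  nsmul := @nsmulRec B ⟨S.zero⟩ ⟨S.add⟩
  zsmul := @zsmulRec B ⟨S.zero⟩ ⟨S.add⟩ ⟨S.neg⟩ (@nsmulRec B ⟨S.zero⟩ ⟨S.add⟩)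

theorem soc_add_mem {s t : B} (hs : s ∈ S.soc) (ht : t ∈ S.soc) : S.add s t ∈ S.soc := by
  let _ := S.toGroup
  let _ := S.toAddGroup
  have h : ∀ a b c : B, a * (b + c) = a * b + -a + a * c := S.compat
  refine ⟨fun b => ?_, fun b => ?_⟩
  · have hst : s + t = s * t := by
      rw [mul_eq_add_lamPerm h]
      exact congrArg (s + ·) (hs.1 t).symm
    change lamPerm h (s + t) b = b
    rw [hst, map_mul]
    exact (congrArg (lamPerm h s) (ht.1 b)).trans (hs.1 b)
  · change s + t + b = b + (s + t)
    have h₁ : s + b = b + s := hs.2 b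
    have h₂ : t + b = b + t := ht.2 b
    rw [_root_.add_assoc, h₂, ← _root_.add_assoc, h₁, _root_.add_assoc]

theorem addCenter_add_mem {s t : B} (hs : s ∈ S.addCenter) (ht : t ∈ S.addCenter) :
    S.add s t ∈ S.addCenter := fun b => by
  rw [S.add_assoc, ht b, ← S.add_assoc, hs b, S.add_assoc]

/-- A map to a finite type separating the left cosets of `I` bounds their number. -/
theorem finite_range_add_image {F : Type*} [Finite F] (f : B → F) {I : Set B}
    (hadd : ∀ s ∈ I, ∀ t ∈ I, S.add s t ∈ I)
    (hf : ∀ b c, f b = f c → S.add (S.neg b) c ∈ I) :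
    (Set.range fun b => S.add b '' I).Finite := by
  have hsub (b c : B) (hbc : f b = f c) : S.add c '' I ⊆ S.add b '' I := by
    rintro _ ⟨t, ht, rfl⟩
    refine ⟨S.add (S.add (S.neg b) c) t, hadd _ (hf b c hbc) t ht, ?_⟩
    rw [← S.add_assoc, ← S.add_assoc, S.add_neg, S.zero_add]
  have hfac : Function.FactorsThrough (fun b => S.add b '' I) f := fun b c hbc =>
    (hsub c b hbc.symm).antisymm (hsub b c hbc)
  refine (Set.finite_range (Function.extend f (fun b => S.add b '' I) fun _ => ∅)).subset ?_
  rintro _ ⟨b, rfl⟩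
  exact ⟨f b, hfac.extend_apply _ b⟩

end SkewBrace

/-- The structure group is generated by the image of the solution. -/
theorem IsStructureSkewBrace.closure_range {X B : Type u} {r : X × X → X × X}
    {S : SkewBrace B} {ι : X → B} (hstr : IsStructureSkewBrace r S ι) :
    letI := S.toGroup
    Subgroup.closure (Set.range ι) = ⊤ := by
  let _ := S.toGroup
  let T : Subgroup B := Subgroup.closure (Set.range ι)
  obtain ⟨φ, ⟨hφ, hφι⟩, -⟩ := hstr.2.1 T
    (fun x => ⟨ι x, Subgroup.subset_closure ⟨x, rfl⟩⟩) fun x y => Subtype.ext (hstr.1 x y)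
  obtain ⟨ψ, -, huniq⟩ := hstr.2.1 B ι hstr.1
  have h₁ := huniq (fun b => (φ b : B))
    ⟨fun a b => congrArg Subtype.val (hφ a b), fun x => congrArg Subtype.val (hφι x)⟩
  have h₂ := huniq id ⟨fun _ _ => rfl, fun _ => rfl⟩
  refine (Subgroup.eq_top_iff' _).2 fun b => ?_
  have hb : (φ b : B) = b := congrFun (h₁.trans h₂.symm) b
  exact hb ▸ (φ b).2

/-- **Theorem.** Let `(X,r)` be a finite non-degenerate set-theoretic solution of the
Yang–Baxter equation and let `B = G(X,r)` be its structure skew brace. Then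
`B/Soc(B)` is finite (the socle has finitely many cosets) and the additive group
`(B,+)` is central-by-finite (its centre has finite index). -/
theorem structure_skew_brace_socle_finite_index {X B : Type u} [Finite X]
    (r : X × X → X × X) (hsol : IsNonDegenerateSolution r)
    (S : SkewBrace B) (ι : X → B) (hstr : IsStructureSkewBrace r S ι) :
    (Set.range fun b => S.add b '' S.soc).Finite ∧
      (Set.range fun b => S.add b '' S.addCenter).Finite := by
  let _ := S.toGroup
  let _ := S.toAddGroup
  have h : ∀ a b c : B, a * (b + c) = a * b + -a + a * c := S.compat
  have hr (x y : X) : lamPerm h (ι x) (ι y) = ι (r (x, y)).1 :=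
    congrArg Prod.fst (hstr.2.2 x y)
  have hlam : ∀ x ∈ Set.range ι, ∀ y ∈ Set.range ι, lamPerm h x y ∈ Set.range ι := by
    rintro _ ⟨x, rfl⟩ _ ⟨y, rfl⟩
    exact ⟨_, (hr x y).symm⟩
  have hconj : ∀ x ∈ Set.range ι, ∀ y ∈ Set.range ι, -y + x + y ∈ Set.range ι := by
    rintro _ ⟨x, rfl⟩ _ ⟨z, rfl⟩
    obtain ⟨y, rfl⟩ := (hsol.2.2.1 x).surjective z
    have hxy : ι x * ι y = ι (r (x, y)).1 * ι (r (x, y)).2 := hstr.1 x y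
    rw [mul_eq_add_lamPerm h, mul_eq_add_lamPerm h, hr, hr] at hxy
    exact ⟨_, by rw [add_assoc, hxy, neg_add_cancel_left]⟩
  obtain ⟨F, _, f, hf⟩ :=
    exists_finite_separating h (Set.finite_range ι) hstr.closure_range hlam hconj
  exact ⟨S.finite_range_add_image f (fun _ hs _ ht => S.soc_add_mem hs ht) fun b c hbc =>
      ⟨fun d => Equiv.Perm.congr_fun (hf b c hbc).1 d, (hf b c hbc).2⟩,
    S.finite_range_add_image f (fun _ hs _ ht => S.addCenter_add_mem hs ht) fun b c hbc =>
      (hf b c hbc).2⟩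
end
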